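/- Let l, k, m be positive integers and α a positive real number. Then α^(l+k) − m·α^l is an integer in [1, (m+1)^(l/k)) if and only if the identity ⌊⌊nα^l⌋·α^k⌋ + ⌊nmα^l⌋ + 1 − m⌊nα^l⌋ = ⌊nα^(l+k)⌋ holds for all nonzero integers n. -/

import Mathlib

lemma aux_dense (a : ℝ) (ha : Irrational a) (u v : ℝ) (huv : u < v) :
    ∃ n k : ℤ, u < n * a + k ∧ n * a + k < v := by
  have hd : Dense (AddSubgroup.closure {a, (1:ℝ)} : Set ℝ) := by
    rw [dense_addSubgroupClosure_pair_iff]; simpa using ha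
  obtain ⟨x, hx, hxu, hxv⟩ := hd.exists_between huv
  rw [SetLike.mem_coe, AddSubgroup.mem_closure_pair] at hx
  obtain ⟨n, k, h⟩ := hx
  refine ⟨n, k, ?_, ?_⟩ <;> simp at h <;> linarith

lemma aux_fract (a : ℝ) (ha : Irrational a) (u v : ℝ) (hu : 0 ≤ u) (hv : v ≤ 1) (huv : u < v) :
    ∃ n : ℤ, n ≠ 0 ∧ u < Int.fract (n * a) ∧ Int.fract (n * a) < v := by
  obtain ⟨n, k, h1, h2⟩ := aux_dense a ha u v huv
  have hf : Int.fract (n * a) = n * a + k := by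
    rw [Int.fract_eq_iff]
    exact ⟨by linarith, by linarith, -k, by push_cast; ring⟩
  refine ⟨n, ?_, by rw [hf]; exact h1, by rw [hf]; exact h2⟩
  rintro rfl
  simp at hf h1 h2
  have h3 : (0:ℝ) < k := by linarith
  rw [← hf] at h3
  exact lt_irrefl _ h3

lemma aux_lin (a β b η : ℝ) (ha : Irrational a) (ha0 : 0 < a) (hb : 0 < b) (hη : 0 < η) (hη1 : η ≤ 1)
    (H : ∀ n k : ℤ, 0 ≤ n * a + k → n * a + k < η →
      ∃ t : ℤ, 0 ≤ n * β - t ∧ n * β - t ≤ b * (n * a + k)) :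
    ∃ p q : ℤ, β = p * a + q := by
  by_contra hcon
  push Not at hcon
  obtain ⟨P0, hP0, hmin⟩ := Finset.exists_min_image (Finset.Icc (0:ℤ) ⌈2 * b⌉)
    (fun P => |β - a * P - round (β - a * P)|)
    ⟨0, by simp; positivity⟩
  set d := |β - a * P0 - round (β - a * P0)| with hd
  have hdpos : 0 < d := by
    rw [hd, abs_pos]
    intro h
    apply hcon P0 (round (β - a * P0))
    linarith
  set C := 2 * b * (1 + a) with hC
  have hCpos : 0 < C := by positivity
  obtain ⟨n, k, hx0, hx1⟩ := aux_dense a ha 0 (min η (d / C)) (lt_min hη (by positivity))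
  set x : ℝ := n * a + k with hx
  have hxη : x < η := lt_of_lt_of_le hx1 (min_le_left _ _)
  have hxd : x < d / C := lt_of_lt_of_le hx1 (min_le_right _ _)
  have hxd' : C * x < d := by rw [lt_div_iff₀ hCpos] at hxd; linarith
  obtain ⟨t, ht0, ht1⟩ := H n k hx0.le hxη
  rw [← hx] at ht1
  set y : ℝ := n * β - t with hy
  have key : ∀ w : ℝ, ∃ J : ℤ, 0 ≤ w - J * x ∧ w - J * x < x := by
    intro w
    refine ⟨⌊w / x⌋, ?_, ?_⟩
    · have := Int.floor_le (w / x)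
      rw [le_div_iff₀ hx0] at this; linarith
    · have := Int.lt_floor_add_one (w / x)
      rw [div_lt_iff₀ hx0] at this; linarith
  obtain ⟨J, hJ0, hJ1⟩ := key 1
  obtain ⟨J', hJ0', hJ1'⟩ := key a
  have e1 : ((-J * n : ℤ) : ℝ) * a + ((1 - J * k : ℤ) : ℝ) = 1 - J * x := by
    rw [hx]; push_cast; ring
  have e2 : ((1 - J' * n : ℤ) : ℝ) * a + ((- J' * k : ℤ) : ℝ) = a - J' * x := by
    rw [hx]; push_cast; ring
  obtain ⟨t1, h10, h11⟩ := H (-J * n) (1 - J * k) (by rw [e1]; exact hJ0) (by rw [e1]; linarith)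
  obtain ⟨t2, h20, h21⟩ := H (1 - J' * n) (-J' * k) (by rw [e2]; exact hJ0') (by rw [e2]; linarith)
  rw [e1] at h11
  rw [e2] at h21
  obtain ⟨P, hP⟩ : ∃ P : ℤ, P = -(t1 + J * t) := ⟨_, rfl⟩
  obtain ⟨Q, hQ⟩ : ∃ Q : ℤ, Q = J' * t + t2 := ⟨_, rfl⟩
  have f1 : ((-J * n : ℤ) : ℝ) * β - t1 = P - J * y := by
    rw [hP, hy]; push_cast; ring
  have f2 : ((1 - J' * n : ℤ) : ℝ) * β - t2 = β - J' * y - Q := by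
    rw [hQ, hy]; push_cast; ring
  rw [f1] at h10 h11
  rw [f2] at h20 h21
  obtain ⟨κ, hκ⟩ : ∃ κ : ℝ, y = κ * x := ⟨y / x, by field_simp⟩
  have hκ0 : 0 ≤ κ := by
    by_contra h; push Not at h
    nlinarith
  have hκb : κ ≤ b := by
    rw [hκ] at ht1; exact le_of_mul_le_mul_right ht1 hx0
  obtain ⟨r, hr⟩ : ∃ r : ℝ, r = 1 - J * x := ⟨_, rfl⟩
  obtain ⟨r', hr'⟩ : ∃ r' : ℝ, r' = a - J' * x := ⟨_, rfl⟩
  have g1 : J * y = κ * (1 - r) := by rw [hκ, hr]; ring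
  have g2 : J' * y = κ * (a - r') := by rw [hκ, hr']; ring
  rw [← hr] at hJ0 hJ1 h11
  rw [← hr'] at hJ0' hJ1' h21
  rw [g1] at h10 h11
  rw [g2] at h20 h21
  have hbr : b * r ≤ b * x := by gcongr
  have hbr' : b * r' ≤ b * x := by gcongr
  have hκr : κ * r ≤ b * x := by gcongr
  have hκr' : κ * r' ≤ b * x := by gcongr
  have hκr0 : 0 ≤ κ * r := by positivity
  have hκr0' : 0 ≤ κ * r' := by positivity
  have hPmem : P ∈ Finset.Icc (0:ℤ) ⌈2 * b⌉ := by
    rw [Finset.mem_Icc]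
    constructor
    · have h0 : 0 ≤ κ * (1 - r) := mul_nonneg hκ0 (by linarith)
      have : (0:ℝ) ≤ P := by linarith
      exact_mod_cast this
    · have h1 : (P:ℝ) ≤ 2 * b := by
        have h2 : b * x ≤ b * 1 := mul_le_mul_of_nonneg_left (by linarith) hb.le
        linarith
      exact_mod_cast h1.trans (Int.le_ceil _)
  have hm := hmin P hPmem
  have hle : |β - a * P - round (β - a * P)| ≤ |β - a * P - Q| := round_le _ _
  have hfin : |β - a * P - Q| ≤ C * x := by
    have i1 : a * (κ * r) ≤ a * (b * x) := mul_le_mul_of_nonneg_left hκr ha0.le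
    have i2 : 0 ≤ a * (κ * r) := mul_nonneg ha0.le hκr0
    have i3 : a * (P - κ * (1 - r)) ≤ a * (b * x) :=
      mul_le_mul_of_nonneg_left (h11.trans hbr) ha0.le
    have i4 : 0 ≤ a * (P - κ * (1 - r)) := mul_nonneg ha0.le h10
    have i5 : β - a * P - Q = (β - κ * (a - r') - Q) - κ * r' + a * (κ * r)
        - a * (P - κ * (1 - r)) := by ring
    have i6 : C * x = 2 * (b * x) + 2 * (a * (b * x)) := by rw [hC]; ring
    have i7 : 0 ≤ b * x := by positivity
    have i8 : 0 ≤ a * (b * x) := by positivity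
    rw [abs_le, i5, i6]
    constructor <;> linarith
  linarith

lemma aux_pow (l k : ℕ) (hk : 1 ≤ k) (α : ℝ) (hα : 0 < α) :
    α ^ l = (α ^ k) ^ ((l : ℝ) / (k : ℝ)) := by
  have : (k:ℝ) ≠ 0 := by positivity
  rw [← Real.rpow_natCast α k, ← Real.rpow_mul hα.le, mul_div_cancel₀ _ this, Real.rpow_natCast]

lemma aux_int (l k m : ℕ) (hk : 1 ≤ k) (M : ℤ) (α : ℝ)
    (h : α ^ (l + k) - (m : ℝ) * α ^ l = (M : ℝ)) (r : ℚ) (hr : (r : ℝ) = α ^ k) :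
    ∃ z : ℤ, (z : ℝ) = α ^ k := by
  have hi : IsIntegral ℤ α := by
    refine ⟨Polynomial.X ^ (l + k) + (-(Polynomial.C (m : ℤ) * Polynomial.X ^ l + Polynomial.C M)), ?_, ?_⟩
    · apply Polynomial.monic_X_pow_add
      rw [Polynomial.degree_neg]
      refine lt_of_le_of_lt (Polynomial.degree_add_le _ _) (max_lt ?_ ?_)
      · refine lt_of_le_of_lt (Polynomial.degree_C_mul_X_pow_le _ _) ?_
        exact_mod_cast (by omega : l < l + k)
      · refine lt_of_le_of_lt Polynomial.degree_C_le ?_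
        exact_mod_cast (by omega : 0 < l + k)
    · rw [← Polynomial.aeval_def]
      simp only [map_add, map_neg, map_mul, map_pow, Polynomial.aeval_X, Polynomial.aeval_C]
      simp only [algebraMap_int_eq, eq_intCast, Int.cast_natCast]
      linarith
  have hi2 : IsIntegral ℤ (algebraMap ℚ ℝ r) := by
    have := hi.pow k
    rw [← hr] at this
    simpa using this
  rw [isIntegral_algebraMap_iff (algebraMap ℚ ℝ).injective] at hi2
  obtain ⟨z, hz⟩ := IsIntegrallyClosed.isIntegral_iff.mp hi2
  refine ⟨z, ?_⟩
  rw [← hr, ← hz]; simp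

lemma floor_split (m : ℤ) (x : ℝ) : ⌊(m:ℝ) * x⌋ = m * ⌊x⌋ + ⌊(m:ℝ) * Int.fract x⌋ := by
  have : (m:ℝ) * x = ((m * ⌊x⌋ : ℤ) : ℝ) + m * Int.fract x := by
    push_cast; rw [← mul_add, Int.floor_add_fract]
  rw [this, Int.floor_intCast_add]

/-- The identity, rewritten when `a * b = p * a + q`. -/
lemma aux_id (a b : ℝ) (ha : 0 < a) (m p q : ℤ) (h : a * b = p * a + q) (n : ℤ) :
    (⌊(⌊(n : ℝ) * a⌋ : ℝ) * b⌋ + ⌊(n : ℝ) * (m : ℝ) * a⌋ + 1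
            - m * ⌊(n : ℝ) * a⌋ = ⌊(n : ℝ) * (a * b)⌋) ↔
    ⌊-(q / a * Int.fract (n * a))⌋ + 1 + ⌊(m:ℝ) * Int.fract (n * a)⌋
      = ⌊(p:ℝ) * Int.fract (n * a)⌋ := by
  have e1 : (n : ℝ) * (m : ℝ) * a = m * (n * a) := by ring
  have e2 : (n : ℝ) * (a * b) = p * (n * a) + ((n * q : ℤ) : ℝ) := by
    rw [h]; push_cast; ring
  have hb : b = p + q / a := by field_simp; linarith
  have e3 : (⌊(n : ℝ) * a⌋ : ℝ) * b = ((p * ⌊(n : ℝ) * a⌋ + n * q : ℤ) : ℝ)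
      + -(q / a * Int.fract (n * a)) := by
    have := Int.floor_add_fract ((n:ℝ) * a)
    have h3 : (⌊(n : ℝ) * a⌋ : ℝ) = n * a - Int.fract (n * a) := by linarith
    rw [hb]; push_cast; rw [h3]; field_simp; ring
  rw [e1, e2, e3, Int.floor_intCast_add, Int.floor_add_intCast, floor_split m (n * a), floor_split p (n * a)]
  constructor <;> intro h <;> linarith

lemma le_of_dense_mul (s B w : ℝ) (hw : w < 1)
    (h : ∀ u, w < u → 0 ≤ u → u < 1 → ∃ f, u < f ∧ f < 1 ∧ s * f ≤ B) : s ≤ B := by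
  by_contra hc
  push Not at hc
  by_cases hs : s ≤ 0
  · obtain ⟨f, h1, h2, h3⟩ := h (max ((w+1)/2) 0) (lt_max_of_lt_left (by linarith)) (le_max_right _ _)
      (max_lt (by linarith) one_pos)
    nlinarith
  · push Not at hs
    obtain ⟨f, h1, h2, h3⟩ := h (max (max ((w+1)/2) 0) (B / s))
      (lt_max_of_lt_left (lt_max_of_lt_left (by linarith)))
      (le_max_of_le_left (le_max_right _ _))
      (max_lt (max_lt (by linarith) one_pos) (by rw [div_lt_one hs]; exact hc))
    have : B / s < f := lt_of_le_of_lt (le_max_right _ _) h1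
    rw [div_lt_iff₀ hs] at this
    linarith

lemma aux_back (a b : ℝ) (ha0 : 0 < a) (hb : 0 < b) (ha : Irrational a) (m : ℤ) (hm : 1 ≤ m)
    (hab : b ≤ 1 → a ≤ 1)
    (H : ∀ n : ℤ, n ≠ 0 → ⌊(⌊(n : ℝ) * a⌋ : ℝ) * b⌋ + ⌊(n : ℝ) * (m : ℝ) * a⌋ + 1
            - m * ⌊(n : ℝ) * a⌋ = ⌊(n : ℝ) * (a * b)⌋) :
    ∃ M : ℤ, a * b - m * a = M ∧ 1 ≤ M ∧ (M:ℝ) < a := by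
  have hmR : (1:ℝ) ≤ m := by exact_mod_cast hm
  have hm0 : (0:ℝ) < m := by linarith
  obtain ⟨p, q, hpq⟩ : ∃ p q : ℤ, a * b = p * a + q := by
    apply aux_lin a (a * b) b (1 / m) ha ha0 hb (by positivity)
      (by rw [div_le_one hm0]; exact hmR)
    intro n k h0 h1
    have h1m : 1 / (m:ℝ) ≤ 1 := by rw [div_le_one hm0]; exact hmR
    by_cases hn : n = 0
    · subst hn
      refine ⟨0, by simp, ?_⟩
      simp at h0 ⊢; positivity
    have hfl : ⌊(n:ℝ) * a⌋ = -k := by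
      rw [Int.floor_eq_iff]; push_cast; constructor <;> linarith
    have hid := H n hn
    have hfl2 : ⌊(n : ℝ) * (m : ℝ) * a⌋ = - m * k := by
      rw [Int.floor_eq_iff]; push_cast
      rw [lt_div_iff₀ hm0] at h1
      constructor <;> nlinarith
    rw [hfl2, hfl] at hid
    refine ⟨⌊(n : ℝ) * (a * b)⌋, by linarith [Int.floor_le ((n : ℝ) * (a * b))], ?_⟩
    have h3 : ⌊((-k : ℤ):ℝ) * b⌋ + 1 = ⌊(n : ℝ) * (a * b)⌋ := by linarith
    have h4 := Int.lt_floor_add_one (((-k : ℤ):ℝ) * b)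
    have h5 : ((⌊((-k : ℤ):ℝ) * b⌋ : ℤ) : ℝ) + 1 = ⌊(n : ℝ) * (a * b)⌋ := by exact_mod_cast h3
    push_cast at h4 h5
    nlinarith
  have F : ∀ n : ℤ, n ≠ 0 → _ := fun n hn => (aux_id a b ha0 m p q hpq n).mp (H n hn)
  set s : ℝ := q / a with hs
  have G : ∀ u v : ℝ, 0 ≤ u → v ≤ 1 → u < v → ∃ f : ℝ, u < f ∧ f < v ∧
      ⌊-(s * f)⌋ + 1 + ⌊(m:ℝ) * f⌋ = ⌊(p:ℝ) * f⌋ := by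
    intro u v hu hv huv
    obtain ⟨n, hn, h1, h2⟩ := aux_fract a ha u v hu hv huv
    exact ⟨_, h1, h2, F n hn⟩
  have hsr : ∀ z : ℤ, s ≠ z ∨ (z = 0) := by
    intro z
    by_contra hc
    push Not at hc
    obtain ⟨hc, hz⟩ := hc
    have hz' : (z:ℝ) ≠ 0 := by exact_mod_cast hz
    apply ha
    refine ⟨q / z, ?_⟩
    push_cast
    rw [hs] at hc
    field_simp at hc ⊢
    linarith
  have hbs : b = p + s := by rw [hs]; field_simp; linarith
  -- small f : s > 0 and p ≥ 0
  have hsmall : 0 < s ∧ 0 ≤ p := by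
    set D : ℝ := |(p:ℝ)| + m + |s| + 1 with hD
    have hDpos : 0 < D := by positivity
    have hD1 : 1 ≤ D := by rw [hD]; linarith [abs_nonneg (p:ℝ), abs_nonneg s]
    obtain ⟨f, h1, h2, h3⟩ := G 0 (1 / D) le_rfl (by rw [div_le_one hDpos]; exact hD1) (by positivity)
    rw [lt_div_iff₀ hDpos, hD] at h2
    have hp1 : |(p:ℝ) * f| < 1 := by
      rw [abs_mul, abs_of_pos h1]; nlinarith [abs_nonneg s, abs_nonneg (p:ℝ)]
    have hs1 : |s * f| < 1 := by
      rw [abs_mul, abs_of_pos h1]; nlinarith [abs_nonneg s, abs_nonneg (p:ℝ)]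
    have hmf : ⌊(m:ℝ) * f⌋ = 0 := by
      rw [Int.floor_eq_zero_iff]
      exact ⟨by positivity, by nlinarith [abs_nonneg s, abs_nonneg (p:ℝ)]⟩
    rw [hmf] at h3
    rw [abs_lt] at hp1 hs1
    have hpf : ⌊(p:ℝ) * f⌋ < 1 := by rw [Int.floor_lt]; push_cast; linarith
    have hsf : ⌊-(s * f)⌋ < 0 := by linarith
    have hsf' : -1 ≤ ⌊-(s * f)⌋ := by rw [Int.le_floor]; push_cast; linarith
    constructor
    · rw [Int.floor_lt] at hsf; push_cast at hsf
      by_contra hc; push Not at hc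
      nlinarith
    · have : 0 ≤ ⌊(p:ℝ) * f⌋ := by linarith
      rw [Int.le_floor] at this; push_cast at this
      by_contra hc; push Not at hc
      have : (p:ℝ) < 0 := by exact_mod_cast hc
      nlinarith
  obtain ⟨hs0, hp0⟩ := hsmall
  have hq1 : 1 ≤ q := by
    have : (0:ℝ) < q := by
      rw [hs] at hs0
      exact (div_pos_iff_of_pos_right ha0).mp hs0
    exact_mod_cast this
  have hp0R : (0:ℝ) ≤ p := by exact_mod_cast hp0
  have nearone : ∀ (z : ℤ) (f : ℝ), 1 ≤ z → f < 1 → 1 - 1 / (m + p + 1) < f → (z ≤ m ∨ z ≤ p) →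
      ⌊(z:ℝ) * f⌋ = z - 1 := by
    intro z f hz hf hf' hzz
    have hzR : (1:ℝ) ≤ z := by exact_mod_cast hz
    have hzz' : (z:ℝ) ≤ m + p + 1 := by
      rcases hzz with h | h
      · have : (z:ℝ) ≤ m := by exact_mod_cast h
        linarith
      · have : (z:ℝ) ≤ p := by exact_mod_cast h
        linarith
    have hpos : (0:ℝ) < m + p + 1 := by positivity
    have h1 : (1 - f) * (m + p + 1) < 1 := by
      rw [← lt_div_iff₀ hpos]; linarith
    rw [Int.floor_eq_iff]; push_cast
    constructor <;> nlinarith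
  have hw1 : (1:ℝ) - 1 / (m + p + 1) < 1 := by
    have : (0:ℝ) < 1 / (m + p + 1) := by positivity
    linarith
  have hw0 : (0:ℝ) ≤ 1 - 1 / (m + p + 1) := by
    have : 1 / ((m:ℝ) + p + 1) ≤ 1 := by rw [div_le_one (by positivity)]; linarith
    linarith
  have hpm : p ≤ m := by
    by_contra hc; push Not at hc
    obtain ⟨f, h1, h2, h3⟩ := G _ 1 hw0 le_rfl hw1
    rw [nearone m f hm h2 h1 (Or.inl le_rfl), nearone p f (by omega) h2 h1 (Or.inr le_rfl)] at h3
    have hf0 : 0 < f := by linarith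
    have : ⌊-(s * f)⌋ < 0 := by rw [Int.floor_lt]; push_cast; nlinarith
    omega
  have hsup : ∀ B : ℤ, ((p = 0 ∧ B = m) ∨ (1 ≤ p ∧ B = m - p + 1)) → s ≤ B := by
    intro B hB
    apply le_of_dense_mul s B _ hw1
    intro u hu hu0 hu1
    obtain ⟨f, h1, h2, h3⟩ := G u 1 hu0 le_rfl hu1
    refine ⟨f, h1, h2, ?_⟩
    rw [nearone m f hm h2 (by linarith) (Or.inl le_rfl)] at h3
    have h4 : -B ≤ ⌊-(s * f)⌋ := by
      rcases hB with ⟨h, h'⟩ | ⟨h, h'⟩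
      · subst h; simp at h3; omega
      · rw [nearone p f (by omega) h2 (by linarith) (Or.inr le_rfl)] at h3; omega
    rw [Int.le_floor] at h4; push_cast at h4; linarith
  rcases hpm.lt_or_eq with hlt | heq
  · exfalso
    have hltR : (p:ℝ) + 1 ≤ m := by exact_mod_cast hlt
    by_cases hm1 : m = 1
    · have hp : p = 0 := by omega
      have h1 := hsup m (Or.inl ⟨hp, rfl⟩)
      rw [hm1] at h1; push_cast at h1
      have hb1 : b ≤ 1 := by rw [hbs, hp]; push_cast; linarith
      have ha1 := hab hb1
      have hq1R : (1:ℝ) ≤ q := by exact_mod_cast hq1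
      rw [hp] at hpq; push_cast at hpq
      have : a = 1 := by nlinarith
      apply ha; exact ⟨1, by rw [this]; simp⟩
    · have hm2 : 2 ≤ m := by omega
      have hm2R : (2:ℝ) ≤ m := by exact_mod_cast hm2
      have hsm : s ≤ m := by
        rcases hp0.eq_or_lt with h | h
        · exact hsup m (Or.inl ⟨h.symm, rfl⟩)
        · have := hsup (m - p + 1) (Or.inr ⟨by omega, rfl⟩)
          push_cast at this
          have : (1:ℝ) ≤ p := by exact_mod_cast h
          linarith
      have hslt : s < m := by
        rcases hsr m with h | h
        · exact lt_of_le_of_ne hsm h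
        · omega
      -- f slightly above 1 / m with s * f < 1, p * f < 1, f < 2 / m
      set E : ℝ := max s (m - 1) with hE
      have hEm : E < m := max_lt hslt (by linarith)
      have hE1 : (m:ℝ) - 1 ≤ E := le_max_right _ _
      have hE0 : 0 < E := by linarith
      obtain ⟨f, h1, h2, h3⟩ := G (1 / m) (1 / E) (by positivity)
        (by rw [div_le_one hE0]; linarith)
        (one_div_lt_one_div_of_lt hE0 hEm)
      have hf0 : 0 < f := lt_trans (by positivity) h1
      rw [div_lt_iff₀ hm0] at h1
      rw [lt_div_iff₀ hE0] at h2
      have hsE : s ≤ E := le_max_left _ _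
      have a1 : (1:ℤ) ≤ ⌊(m:ℝ) * f⌋ := by rw [Int.le_floor]; push_cast; linarith
      have a2 : ⌊(p:ℝ) * f⌋ < 1 := by rw [Int.floor_lt]; push_cast; nlinarith
      have a3 : -1 ≤ ⌊-(s * f)⌋ := by rw [Int.le_floor]; push_cast; nlinarith
      omega
  · have h1 := hsup 1 (Or.inr ⟨by omega, by omega⟩)
    have h2 : s < 1 := by
      push_cast at h1
      rcases hsr 1 with h | h
      · push_cast at h; exact lt_of_le_of_ne h1 h
      · omega
    refine ⟨q, by rw [hpq, heq]; ring, hq1, ?_⟩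
    rw [hs, div_lt_one ha0] at h2
    exact h2

theorem stmt_12 (l k m : ℕ) (hl : 1 ≤ l) (hk : 1 ≤ k) (hm : 1 ≤ m)
    (α : ℝ) (hα : 0 < α) :
    (∃ M : ℤ, α ^ (l + k) - (m : ℝ) * α ^ l = (M : ℝ) ∧ 1 ≤ (M : ℝ) ∧
        (M : ℝ) < ((m : ℝ) + 1) ^ ((l : ℝ) / (k : ℝ))) ↔
      (∀ n : ℤ, n ≠ 0 →
        ⌊(⌊(n : ℝ) * α ^ l⌋ : ℝ) * α ^ k⌋ + ⌊(n : ℝ) * (m : ℝ) * α ^ l⌋ + 1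
            - (m : ℤ) * ⌊(n : ℝ) * α ^ l⌋ = ⌊(n : ℝ) * α ^ (l + k)⌋) := by
  have ha0 : 0 < α ^ l := by positivity
  have hb0 : 0 < α ^ k := by positivity
  have hexp : 0 < (l:ℝ) / k := by positivity
  constructor
  · rintro ⟨M, hM, hM1, hM2⟩ n hn
    have hzint := aux_int l k m hk M α hM
    have hpow := aux_pow l k hk α hα
    rw [pow_add] at hM ⊢
    set a := α ^ l with ha
    set b := α ^ k with hb
    have hbm : (m:ℝ) < b := by
      by_contra h; push Not at h
      nlinarith
    have hbm1 : b < m + 1 := by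
      by_contra h; push Not at h
      have : ((m : ℝ) + 1) ^ ((l : ℝ) / (k : ℝ)) ≤ a := by
        rw [hpow]; exact Real.rpow_le_rpow (by positivity) h hexp.le
      nlinarith
    have hMa : M < a := by nlinarith
    have hirr : Irrational a := by
      rintro ⟨r, hr⟩
      obtain ⟨z, hz⟩ := hzint (m + M / r) (by
        push_cast; rw [hr]; field_simp; linarith)
      rw [← hz] at hbm hbm1
      have h1 : (m:ℤ) < z := by exact_mod_cast hbm
      have h2 : z < (m:ℤ) + 1 := by exact_mod_cast hbm1
      omega
    have hid := aux_id a b ha0 (m:ℤ) (m:ℤ) M (by push_cast; linarith) n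
    push_cast at hid
    rw [hid]
    have hf0 : 0 < Int.fract (n * a) := by
      refine lt_of_le_of_ne (Int.fract_nonneg _) (fun h => ?_)
      have h1 := Int.floor_add_fract ((n:ℝ) * a)
      rw [← h] at h1
      exact (hirr.intCast_mul hn) ⟨⌊(n:ℝ) * a⌋, by push_cast; linarith⟩
    have hf1 := Int.fract_lt_one ((n:ℝ) * a)
    have hMa' : (M:ℝ) / a < 1 := by rw [div_lt_one ha0]; exact hMa
    have hMa0 : 0 < (M:ℝ) / a := by apply div_pos <;> linarith
    have : ⌊-((M:ℝ) / a * Int.fract (n * a))⌋ = -1 := by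
      rw [Int.floor_eq_iff]; push_cast
      constructor <;> nlinarith
    rw [this]; ring
  · intro H
    have hpow := aux_pow l k hk α hα
    have hab : α ^ k ≤ 1 → α ^ l ≤ 1 := by
      intro h
      exact pow_le_one₀ hα.le ((pow_le_one_iff_of_nonneg hα.le (by omega)).mp h)
    simp only [pow_add] at H ⊢
    set a := α ^ l with ha
    set b := α ^ k with hb
    have hirr : Irrational a := by
      rintro ⟨r, hr⟩
      have hd : (r.den : ℝ) * a = r.num := by
        rw [← hr]; exact_mod_cast Rat.den_mul_eq_num r
      have h := H r.den (by exact_mod_cast r.den_nz)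
      have e1 : ((r.den : ℤ) : ℝ) * a = r.num := by exact_mod_cast hd
      have e2 : ((r.den : ℤ) : ℝ) * m * a = ((m * r.num : ℤ) : ℝ) := by
        push_cast at e1 ⊢; rw [← e1]; ring
      have e3 : ((r.den : ℤ) : ℝ) * (a * b) = r.num * b := by rw [← e1]; ring
      rw [e3, e2, e1, Int.floor_intCast, Int.floor_intCast] at h
      linarith
    obtain ⟨M, h1, h2, h3⟩ := aux_back a b ha0 hb0 hirr (m:ℤ) (by exact_mod_cast hm) hab
      (by intro n hn; exact_mod_cast H n hn)
    push_cast at h1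
    have h2R : (1:ℝ) ≤ M := by exact_mod_cast h2
    refine ⟨M, h1, h2R, h3.trans ?_⟩
    rw [hpow]
    apply Real.rpow_lt_rpow hb0.le _ hexp
    by_contra h; push Not at h
    nlinarith
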